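/- Let Ω ⊂ ℝ^d be a bounded open set, a_{ij} ∈ L∞(Ω; ℂ) and suppose the form B(u,v) = Σ_{ij} ∫_Ω a_{ij} ∂_j u ∂_i v̄ dx satisfies Re B(v,v) ≥ ρ ‖v‖²_{H¹(Ω)} for all v ∈ C_c^∞(Ω) with ρ > 0. Then for almost every x ∈ Ω and every ξ ∈ ℝ^d, Re Σ_{ij} a_{ij}(x) ξ_i ξ_j ≥ ρ ‖ξ‖². (Coercivity implies uniform strong ellipticity with the same constant.) -/

import Mathlib

open MeasureTheory

/-- Partial derivative `∂_j u` of `u : ℝ^d → ℂ`. -/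
noncomputable def pd {d : ℕ} (j : Fin d) (u : EuclideanSpace ℝ (Fin d) → ℂ)
    (x : EuclideanSpace ℝ (Fin d)) : ℂ :=
  fderiv ℝ u x (EuclideanSpace.single j 1)

noncomputable def osc {d : ℕ} (L : EuclideanSpace ℝ (Fin d) →L[ℝ] ℝ) (φ : EuclideanSpace ℝ (Fin d) → ℝ)
    (t : ℝ) (x : EuclideanSpace ℝ (Fin d)) : ℂ :=
  Complex.exp (((t * L x : ℝ) : ℂ) * Complex.I) * (φ x : ℂ)

lemma pd_osc {d : ℕ} (L : EuclideanSpace ℝ (Fin d) →L[ℝ] ℝ) (φ : EuclideanSpace ℝ (Fin d) → ℝ)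
    (hφ : ContDiff ℝ (⊤ : ℕ∞) φ) (t : ℝ) (j : Fin d) (x : EuclideanSpace ℝ (Fin d)) :
    pd j (osc L φ t) x = Complex.exp (((t * L x : ℝ) : ℂ) * Complex.I) *
      (((t * L (EuclideanSpace.single j 1) * φ x : ℝ) : ℂ) * Complex.I
        + ((fderiv ℝ φ x (EuclideanSpace.single j 1) : ℝ) : ℂ)) := by
  have h1 : HasFDerivAt (fun x => (φ x : ℂ)) (Complex.ofRealCLM.comp (fderiv ℝ φ x)) x :=
    Complex.ofRealCLM.hasFDerivAt.comp x
      ((hφ.differentiable (by simp)) x).hasFDerivAt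
  have h2 : HasFDerivAt (fun x => ((t * L x : ℝ) : ℂ)) (Complex.ofRealCLM.comp (t • L)) x :=
    Complex.ofRealCLM.hasFDerivAt.comp x (L.hasFDerivAt.const_mul t)
  have h3 := ((h2.mul_const Complex.I).cexp).mul h1
  have : osc L φ t = (fun x => Complex.exp (((t * L x : ℝ) : ℂ) * Complex.I)) * fun x => (φ x : ℂ) := rfl
  rw [pd, this, h3.fderiv]
  simp
  ring

lemma osc_contDiff {d : ℕ} (L : EuclideanSpace ℝ (Fin d) →L[ℝ] ℝ) (φ : EuclideanSpace ℝ (Fin d) → ℝ)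
    (hφ : ContDiff ℝ (⊤ : ℕ∞) φ) (t : ℝ) : ContDiff ℝ (⊤ : ℕ∞) (osc L φ t) := by
  unfold osc
  have h1 : ContDiff ℝ (⊤ : ℕ∞) (fun x => (φ x : ℂ)) := Complex.ofRealCLM.contDiff.comp hφ
  have h2 : ContDiff ℝ (⊤ : ℕ∞) (fun x => ((t * L x : ℝ) : ℂ)) :=
    Complex.ofRealCLM.contDiff.comp (contDiff_const.mul L.contDiff)
  exact ((h2.mul contDiff_const).cexp).mul h1

lemma osc_support {d : ℕ} (L : EuclideanSpace ℝ (Fin d) →L[ℝ] ℝ) (φ : EuclideanSpace ℝ (Fin d) → ℝ)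
    (t : ℝ) : Function.support (osc L φ t) = Function.support φ := by
  ext x; simp [osc]

lemma norm_osc {d : ℕ} (L : EuclideanSpace ℝ (Fin d) →L[ℝ] ℝ) (φ : EuclideanSpace ℝ (Fin d) → ℝ)
    (t : ℝ) (x) : ‖osc L φ t x‖ ^ 2 = φ x ^ 2 := by
  rw [osc, norm_mul, Complex.norm_exp_ofReal_mul_I]; simp

lemma norm_pd_osc {d : ℕ} (L : EuclideanSpace ℝ (Fin d) →L[ℝ] ℝ) (φ : EuclideanSpace ℝ (Fin d) → ℝ)
    (hφ : ContDiff ℝ (⊤ : ℕ∞) φ) (t : ℝ) (j : Fin d) (x : EuclideanSpace ℝ (Fin d)) :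
    ‖pd j (osc L φ t) x‖ ^ 2 = (t ^ 2 * L (EuclideanSpace.single j 1) ^ 2) * φ x ^ 2 +
      fderiv ℝ φ x (EuclideanSpace.single j 1) ^ 2 := by
  rw [pd_osc L φ hφ, norm_mul, Complex.norm_exp_ofReal_mul_I, one_mul, Complex.sq_norm,
    Complex.normSq_apply]
  simp
  ring

lemma prod_pd_osc {d : ℕ} (L : EuclideanSpace ℝ (Fin d) →L[ℝ] ℝ) (φ : EuclideanSpace ℝ (Fin d) → ℝ)
    (hφ : ContDiff ℝ (⊤ : ℕ∞) φ) (t : ℝ) (i j : Fin d) (x : EuclideanSpace ℝ (Fin d)) (z : ℂ) :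
    z * pd j (osc L φ t) x * (starRingEnd ℂ) (pd i (osc L φ t) x) =
      (t : ℂ) ^ 2 * (z * ((L (EuclideanSpace.single i 1) * L (EuclideanSpace.single j 1) * φ x ^ 2 : ℝ) : ℂ)) +
      (t : ℂ) * (Complex.I * (z * ((L (EuclideanSpace.single j 1) * φ x *
          fderiv ℝ φ x (EuclideanSpace.single i 1) - L (EuclideanSpace.single i 1) * φ x *
          fderiv ℝ φ x (EuclideanSpace.single j 1) : ℝ) : ℂ))) +
      z * ((fderiv ℝ φ x (EuclideanSpace.single i 1) * fderiv ℝ φ x (EuclideanSpace.single j 1) : ℝ) : ℂ) := by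
  rw [pd_osc L φ hφ, pd_osc L φ hφ]
  set e := Complex.exp (((t * L x : ℝ) : ℂ) * Complex.I) with he
  have h : e * (starRingEnd ℂ) e = 1 := by
    rw [Complex.mul_conj, Complex.normSq_eq_norm_sq, he, Complex.norm_exp_ofReal_mul_I]; simp
  simp only [map_mul, map_add, Complex.conj_ofReal, Complex.conj_I]
  push_cast
  linear_combination (z * (t * L (EuclideanSpace.single j 1) * φ x * Complex.I + fderiv ℝ φ x (EuclideanSpace.single j 1)) * (- (t * L (EuclideanSpace.single i 1) * φ x * Complex.I) + fderiv ℝ φ x (EuclideanSpace.single i 1))) * h - z * (t ^ 2 * L (EuclideanSpace.single i 1) * L (EuclideanSpace.single j 1) * φ x ^ 2) * Complex.I_sq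

lemma quad_nonneg (α β γ : ℝ) (h : ∀ t : ℝ, 0 ≤ t ^ 2 * α + t * β + γ) : 0 ≤ α := by
  by_contra hα
  push Not at hα
  have hs : ∀ t : ℝ, 0 ≤ t ^ 2 * α + γ := fun t => by
    have h1 := h t
    have h2 := h (-t)
    nlinarith
  have h0 := hs 0
  have h1 := hs (1 + γ / (-α))
  have hg : 0 ≤ γ := by simpa using h0
  have hq : 0 ≤ γ / (-α) := div_nonneg hg (by linarith)
  have he : γ / (-α) * α = -γ := by
    have := hα.ne
    field_simp
  nlinarith [mul_nonneg hq hg]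

lemma key {d : ℕ} (Ω : Set (EuclideanSpace ℝ (Fin d)))
    (a : Fin d → Fin d → EuclideanSpace ℝ (Fin d) → ℂ)
    (hameas : ∀ i j, Measurable (a i j)) (M : ℝ) (hM : ∀ i j x, ‖a i j x‖ ≤ M)
    (ρ : ℝ) (hρ : 0 < ρ)
    (hcoer : ∀ v : EuclideanSpace ℝ (Fin d) → ℂ, ContDiff ℝ (⊤ : ℕ∞) v → HasCompactSupport v →
      tsupport v ⊆ Ω →
      ρ * ((∫ x in Ω, ‖v x‖ ^ 2) + ∑ j, ∫ x in Ω, ‖pd j v x‖ ^ 2) ≤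
        (∑ i, ∑ j, ∫ x in Ω, a i j x * pd j v x * (starRingEnd ℂ) (pd i v x)).re)
    (ξ : Fin d → ℝ) (φ : EuclideanSpace ℝ (Fin d) → ℝ) (hφ : ContDiff ℝ (⊤ : ℕ∞) φ)
    (hc : HasCompactSupport φ) (hs : tsupport φ ⊆ Ω) :
    0 ≤ ∫ x in Ω, ((∑ i, ∑ j, a i j x * (ξ i : ℂ) * (ξ j : ℂ)).re - ρ * ∑ i, ξ i ^ 2) * φ x ^ 2 := by
  set L : EuclideanSpace ℝ (Fin d) →L[ℝ] ℝ := innerSL ℝ (WithLp.toLp 2 ξ) with hL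
  have hLs : ∀ j, L (EuclideanSpace.single j 1) = ξ j := fun j => by
    simp [hL, EuclideanSpace.inner_single_right]
  have hD : ∀ j, Continuous fun x => fderiv ℝ φ x (EuclideanSpace.single j 1) := fun j =>
    (hφ.continuous_fderiv (by simp)).clm_apply continuous_const
  have hDc : ∀ j, HasCompactSupport fun x => fderiv ℝ φ x (EuclideanSpace.single j 1) := fun j =>
    (hc.fderiv_apply (𝕜 := ℝ) _)
  have hφc := hφ.continuous
  have hint : ∀ f : EuclideanSpace ℝ (Fin d) → ℝ, Continuous f → HasCompactSupport f →
      Integrable f (volume.restrict Ω) := fun f h1 h2 =>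
    (h1.integrable_of_hasCompactSupport h2).restrict
  have hintC : ∀ i j, ∀ f : EuclideanSpace ℝ (Fin d) → ℝ, Continuous f → HasCompactSupport f →
      Integrable (fun x => a i j x * (f x : ℂ)) (volume.restrict Ω) := fun i j f h1 h2 =>
    (hint f h1 h2).ofReal.bdd_mul (hameas i j).aestronglyMeasurable
      (Filter.Eventually.of_forall (hM i j))
  have hcsq : HasCompactSupport fun x => φ x ^ 2 := by
    simp only [pow_two]
    exact hc.mul_left
  have hφ2 : Integrable (fun x => φ x ^ 2) (volume.restrict Ω) :=
    hint _ (hφc.pow 2) hcsq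
  have hD2 : ∀ j, Integrable (fun x => fderiv ℝ φ x (EuclideanSpace.single j 1) ^ 2)
      (volume.restrict Ω) := fun j =>
    hint _ ((hD j).pow 2) (by simp only [pow_two]; exact (hDc j).mul_left)
  have hA : ∀ i j, Integrable (fun x => a i j x * ((ξ i * ξ j * φ x ^ 2 : ℝ) : ℂ))
      (volume.restrict Ω) := fun i j => hintC i j _ (by fun_prop)
        (HasCompactSupport.mul_left hcsq)
  have hB : ∀ i j, Integrable (fun x => a i j x * ((ξ j * φ x *
          fderiv ℝ φ x (EuclideanSpace.single i 1) - ξ i * φ x *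
          fderiv ℝ φ x (EuclideanSpace.single j 1) : ℝ) : ℂ))
      (volume.restrict Ω) := fun i j => hintC i j _
        (((continuous_const.mul hφc).mul (hD i)).sub ((continuous_const.mul hφc).mul (hD j)))
        (((hDc i).mul_left).sub ((hDc j).mul_left))
  have hC : ∀ i j, Integrable (fun x => a i j x * ((fderiv ℝ φ x (EuclideanSpace.single i 1) *
      fderiv ℝ φ x (EuclideanSpace.single j 1) : ℝ) : ℂ))
      (volume.restrict Ω) := fun i j => hintC i j _ ((hD i).mul (hD j)) ((hDc j).mul_left)
  have e1 : ∀ t j, ∫ x in Ω, ‖pd j (osc L φ t) x‖ ^ 2 = t ^ 2 * (ξ j ^ 2 * ∫ x in Ω, φ x ^ 2) +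
      ∫ x in Ω, fderiv ℝ φ x (EuclideanSpace.single j 1) ^ 2 := fun t j => by
    simp_rw [norm_pd_osc L φ hφ, hLs]
    rw [integral_add (hφ2.const_mul _) (hD2 j), integral_const_mul]
    ring
  have e2 : ∀ (t : ℝ) i j, ∫ x in Ω, a i j x * pd j (osc L φ t) x *
      (starRingEnd ℂ) (pd i (osc L φ t) x) =
      (t : ℂ) ^ 2 * (∫ x in Ω, a i j x * ((ξ i * ξ j * φ x ^ 2 : ℝ) : ℂ)) +
      (t : ℂ) * (Complex.I * ∫ x in Ω, a i j x * ((ξ j * φ x *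
          fderiv ℝ φ x (EuclideanSpace.single i 1) - ξ i * φ x *
          fderiv ℝ φ x (EuclideanSpace.single j 1) : ℝ) : ℂ)) +
      ∫ x in Ω, a i j x * ((fderiv ℝ φ x (EuclideanSpace.single i 1) *
      fderiv ℝ φ x (EuclideanSpace.single j 1) : ℝ) : ℂ) := fun t i j => by
    simp_rw [prod_pd_osc L φ hφ, hLs]
    refine (integral_add ((hA i j).const_mul _ |>.add (((hB i j).const_mul _).const_mul _))
      (hC i j)).trans ?_
    congr 1
    refine (integral_add ((hA i j).const_mul _) (((hB i j).const_mul _).const_mul _)).trans ?_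
    rw [integral_const_mul, integral_const_mul, integral_const_mul]
  have main : 0 ≤ (∑ i, ∑ j, ∫ x in Ω, a i j x * ((ξ i * ξ j * φ x ^ 2 : ℝ) : ℂ)).re -
      ρ * ∑ j, ξ j ^ 2 * ∫ x in Ω, φ x ^ 2 := by
    have hts : ∀ t, tsupport (osc L φ t) = tsupport φ := fun t => by
      rw [tsupport, osc_support, tsupport]
    refine quad_nonneg _
      (∑ i, ∑ j, Complex.I * ∫ x in Ω, a i j x * ((ξ j * φ x *
          fderiv ℝ φ x (EuclideanSpace.single i 1) - ξ i * φ x *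
          fderiv ℝ φ x (EuclideanSpace.single j 1) : ℝ) : ℂ)).re
      ((∑ i, ∑ j, ∫ x in Ω, a i j x * ((fderiv ℝ φ x (EuclideanSpace.single i 1) *
      fderiv ℝ φ x (EuclideanSpace.single j 1) : ℝ) : ℂ)).re -
      ρ * ((∫ x in Ω, φ x ^ 2) + ∑ j, ∫ x in Ω, fderiv ℝ φ x (EuclideanSpace.single j 1) ^ 2))
      fun t => ?_
    have h := hcoer (osc L φ t) (osc_contDiff L φ hφ t)
      (by rw [HasCompactSupport, hts]; exact hc) (by rw [hts]; exact hs)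
    simp_rw [e1, e2, norm_osc, Finset.sum_add_distrib, ← Finset.mul_sum] at h
    rw [← Complex.ofReal_pow, Complex.add_re, Complex.add_re, Complex.re_ofReal_mul,
      Complex.re_ofReal_mul] at h
    simp_rw [← Finset.mul_sum]
    linarith
  have hre : ∀ x, ((∑ i, ∑ j, a i j x * (ξ i : ℂ) * (ξ j : ℂ)).re - ρ * ∑ i, ξ i ^ 2) * φ x ^ 2
      = (∑ i, ∑ j, a i j x * ((ξ i * ξ j * φ x ^ 2 : ℝ) : ℂ)).re -
        (ρ * ∑ i, ξ i ^ 2) * φ x ^ 2 := fun x => by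
    rw [sub_mul, mul_comm (Complex.re _), ← Complex.re_ofReal_mul, Finset.mul_sum]
    congr 2
    refine Finset.sum_congr rfl fun i _ => ?_
    rw [Finset.mul_sum]
    refine Finset.sum_congr rfl fun j _ => ?_
    push_cast
    ring
  have hsum : Integrable (fun x => ∑ i, ∑ j, a i j x * ((ξ i * ξ j * φ x ^ 2 : ℝ) : ℂ))
      (volume.restrict Ω) :=
    integrable_finsetSum _ fun i _ => integrable_finsetSum _ fun j _ => hA i j
  have hI : ∫ x in Ω, ∑ i, ∑ j, a i j x * ((ξ i * ξ j * φ x ^ 2 : ℝ) : ℂ) =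
      ∑ i, ∑ j, ∫ x in Ω, a i j x * ((ξ i * ξ j * φ x ^ 2 : ℝ) : ℂ) := by
    rw [integral_finsetSum _ fun i _ => integrable_finsetSum _ fun j _ => hA i j]
    exact Finset.sum_congr rfl fun i _ => integral_finsetSum _ fun j _ => hA i j
  simp_rw [hre]
  refine le_of_le_of_eq ?_ (integral_sub hsum.re (hφ2.const_mul _)).symm
  rw [integral_const_mul]
  have hI2 : ∫ x in Ω, (∑ i, ∑ j, a i j x * ((ξ i * ξ j * φ x ^ 2 : ℝ) : ℂ)).re =
      (∫ x in Ω, ∑ i, ∑ j, a i j x * ((ξ i * ξ j * φ x ^ 2 : ℝ) : ℂ)).re := integral_re hsum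
  rw [← Finset.sum_mul] at main
  have hI3 := hI2.trans (congrArg Complex.re hI)
  refine le_of_le_of_eq main ?_
  rw [← hI3, mul_assoc]
  rfl

open Filter Topology Set Metric Function in
lemma nonneg_of_test {d : ℕ} (Ω : Set (EuclideanSpace ℝ (Fin d))) (hΩo : IsOpen Ω)
    (hΩb : Bornology.IsBounded Ω) (g : EuclideanSpace ℝ (Fin d) → ℝ) (hg : Measurable g)
    (C : ℝ) (hC : ∀ x, ‖g x‖ ≤ C)
    (h : ∀ φ : EuclideanSpace ℝ (Fin d) → ℝ, ContDiff ℝ (⊤ : ℕ∞) φ → HasCompactSupport φ →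
      tsupport φ ⊆ Ω → 0 ≤ ∫ x in Ω, g x * φ x ^ 2) :
    ∀ᵐ x ∂(volume.restrict Ω), 0 ≤ g x := by
  have hfin : volume Ω < ⊤ := hΩb.measure_lt_top
  have : IsFiniteMeasure (volume.restrict Ω) := ⟨by simpa using hfin⟩
  -- the integral over compact subsets is nonnegative
  have hK : ∀ K : Set (EuclideanSpace ℝ (Fin d)), IsCompact K → K ⊆ Ω → 0 ≤ ∫ x in K, g x := by
    intro K hK hKΩ
    obtain ⟨δ, δpos, hδ⟩ := hK.exists_cthickening_subset_open hΩo hKΩ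
    obtain ⟨u, -, u_pos, u_lim⟩ : ∃ u, StrictAnti u ∧ (∀ (n : ℕ), u n ∈ Ioo 0 δ)
      ∧ Tendsto u atTop (𝓝 0) := exists_seq_strictAnti_tendsto' δpos
    have : ∀ n, ∃ f : EuclideanSpace ℝ (Fin d) → ℝ, support f = thickening (u n) K ∧
        ContDiff ℝ (⊤ : ℕ∞) f ∧ Set.range f ⊆ Set.Icc 0 1 ∧ ∀ x ∈ K, f x = 1 := by
      intro n
      rcases exists_contMDiff_support_eq_eq_one_iff (n := (⊤ : ℕ∞))
        (modelWithCornersSelf ℝ (EuclideanSpace ℝ (Fin d)))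
        isOpen_thickening hK.isClosed
        (self_subset_thickening (u_pos n).1 K) with ⟨f, f_smooth, f_range, f_supp, hf⟩
      exact ⟨f, f_supp, f_smooth.contDiff, f_range, fun x hx ↦ (hf x).1 hx⟩
    choose f f_supp f_diff f_range hf using this
    have hts : ∀ n, tsupport (f n) ⊆ cthickening δ K := fun n => by
      rw [tsupport, f_supp]
      exact (closure_thickening_subset_cthickening _ _).trans (cthickening_mono (u_pos n).2.le _)
    have hlim : Tendsto (fun n => ∫ x in Ω, g x * f n x ^ 2) atTop
        (𝓝 (∫ x in Ω, K.indicator g x)) := by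
      refine tendsto_integral_of_dominated_convergence (fun _ => C) (fun n => ?_)
        (integrable_const _) (fun n => Eventually.of_forall fun x => ?_)
        (Eventually.of_forall fun x => ?_)
      · exact (hg.mul ((f_diff n).continuous.measurable.pow_const 2)).aestronglyMeasurable
      · have h1 := f_range n (mem_range_self x)
        rw [norm_mul]
        have h2 : ‖f n x ^ 2‖ ≤ 1 := by
          rw [Real.norm_of_nonneg (sq_nonneg _)]
          exact pow_le_one₀ h1.1 h1.2
        exact (mul_le_of_le_one_right (norm_nonneg _) h2).trans (hC x)
      · by_cases hx : x ∈ K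
        · simp [hf _ x hx, indicator_of_mem hx]
        · rw [indicator_of_notMem hx]
          apply tendsto_const_nhds.congr'
          obtain ⟨ε, εpos, hε⟩ : ∃ ε, 0 < ε ∧ x ∉ thickening ε K := by
            rw [← hK.isClosed.closure_eq, closure_eq_iInter_thickening K] at hx
            simpa using hx
          filter_upwards [(tendsto_order.1 u_lim).2 _ εpos] with n hn
          have : f n x = 0 := by
            rw [← notMem_support, f_supp]
            exact fun hh => hε (thickening_mono hn.le K hh)
          simp [this]
    have h0 := ge_of_tendsto' hlim fun n => h (f n) (f_diff n)
      (hK.cthickening.of_isClosed_subset (isClosed_tsupport _) (hts n)) ((hts n).trans hδ)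
    rwa [setIntegral_indicator hK.measurableSet, inter_eq_self_of_subset_right hKΩ] at h0
  by_contra hne
  have hN : MeasurableSet ({x | g x < 0} ∩ Ω) :=
    (measurableSet_lt hg measurable_const).inter hΩo.measurableSet
  have hpos : 0 < volume ({x | g x < 0} ∩ Ω) := by
    rw [pos_iff_ne_zero]
    intro h0
    apply hne
    rw [ae_iff]
    simp only [not_le]
    rwa [Measure.restrict_apply (measurableSet_lt hg measurable_const)]
  obtain ⟨K, hKN, hKc, hKpos⟩ := hN.exists_lt_isCompact hpos
  have hi : IntegrableOn g K :=
    Measure.integrableOn_of_bounded hKc.measure_lt_top.ne hg.aestronglyMeasurable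
      (M := C) (Eventually.of_forall hC)
  have h1 := hK K hKc (hKN.trans inter_subset_right)
  have h2 : 0 < ∫ x in K, -g x := by
    refine (setIntegral_pos_iff_support_of_nonneg_ae ?_ hi.neg).2 ?_
    rotate_left
    · refine hKpos.trans_le (measure_mono fun x hx => ⟨?_, hx⟩)
      have : g x < 0 := (hKN hx).1
      simp [this.ne]
    · filter_upwards [ae_restrict_mem hKc.measurableSet] with x hx
      have : g x < 0 := (hKN hx).1
      simp [this.le]
  rw [integral_neg] at h2
  linarith

/-- Coercivity of the Dirichlet form on smooth compactly supported test functions implies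
uniform strong ellipticity with the same constant: a.e. on `Ω`,
`Re Σ_{ij} a_{ij}(x) ξ_i ξ_j ≥ ρ ‖ξ‖²`. -/
theorem stmt7 {d : ℕ} (Ω : Set (EuclideanSpace ℝ (Fin d))) (hΩo : IsOpen Ω)
    (hΩb : Bornology.IsBounded Ω)
    (a : Fin d → Fin d → EuclideanSpace ℝ (Fin d) → ℂ)
    (hameas : ∀ i j, Measurable (a i j)) (M : ℝ) (hM : ∀ i j x, ‖a i j x‖ ≤ M)
    (ρ : ℝ) (hρ : 0 < ρ)
    (hcoer : ∀ v : EuclideanSpace ℝ (Fin d) → ℂ, ContDiff ℝ (⊤ : ℕ∞) v → HasCompactSupport v →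
      tsupport v ⊆ Ω →
      ρ * ((∫ x in Ω, ‖v x‖ ^ 2) + ∑ j, ∫ x in Ω, ‖pd j v x‖ ^ 2) ≤
        (∑ i, ∑ j, ∫ x in Ω, a i j x * pd j v x * (starRingEnd ℂ) (pd i v x)).re) :
    ∀ᵐ x ∂(volume.restrict Ω), ∀ ξ : Fin d → ℝ,
      ρ * ∑ i, ξ i ^ 2 ≤ (∑ i, ∑ j, a i j x * (ξ i : ℂ) * (ξ j : ℂ)).re := by
  have hall : ∀ ξ : Fin d → ℝ, ∀ᵐ x ∂(volume.restrict Ω),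
      0 ≤ (∑ i, ∑ j, a i j x * (ξ i : ℂ) * (ξ j : ℂ)).re - ρ * ∑ i, ξ i ^ 2 := by
    intro ξ
    refine nonneg_of_test Ω hΩo hΩb _ ?_
      ((∑ i, ∑ j, M * ‖(ξ i : ℂ)‖ * ‖(ξ j : ℂ)‖) + ‖ρ * ∑ i, ξ i ^ 2‖) (fun x => ?_)
      (key Ω a hameas M hM ρ hρ hcoer ξ)
    · refine Measurable.sub_const (Complex.measurable_re.comp ?_) _
      refine Finset.measurable_sum _ fun i _ => Finset.measurable_sum _ fun j _ => ?_
      exact ((hameas i j).mul_const _).mul_const _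
    · refine (norm_sub_le _ _).trans (add_le_add_left ?_ _)
      refine (Complex.abs_re_le_norm _).trans ?_
      refine (norm_sum_le _ _).trans (Finset.sum_le_sum fun i _ => ?_)
      refine (norm_sum_le _ _).trans (Finset.sum_le_sum fun j _ => ?_)
      rw [norm_mul, norm_mul]
      gcongr
      exact hM i j x
  obtain ⟨S, hSc, hSd⟩ := TopologicalSpace.exists_countable_dense (Fin d → ℝ)
  have hS : ∀ᵐ x ∂(volume.restrict Ω), ∀ ξ ∈ S,
      0 ≤ (∑ i, ∑ j, a i j x * (ξ i : ℂ) * (ξ j : ℂ)).re - ρ * ∑ i, ξ i ^ 2 :=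
    (ae_ball_iff hSc).2 fun ξ _ => hall ξ
  filter_upwards [hS] with x hx ξ
  have hcl : IsClosed {ξ : Fin d → ℝ |
      0 ≤ (∑ i, ∑ j, a i j x * (ξ i : ℂ) * (ξ j : ℂ)).re - ρ * ∑ i, ξ i ^ 2} := by
    refine isClosed_le continuous_const (Continuous.sub (Complex.continuous_re.comp ?_) ?_)
    · fun_prop
    · fun_prop
  have hsub := hcl.closure_subset_iff.2 (show S ⊆ _ from hx)
  have := hsub (hSd ξ)
  simp only [Set.mem_ofPred_eq] at this
  linarith
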